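/- arXiv:1011.0080 — 2 statements merged into one kernel-verified Lean document; each statement's English description precedes it below -/
import Mathlib

section
/- Let M be a finite extension of Q_p with valuation ring O_M, uniformizer π_M, and ramification index e over Q_p (so p·O_M = π_M^e·O_M). Let q ≥ 1 and let F : O_M → O_M be a ring homomorphism such that F(z) − z^{p^q} ∈ π_M·O_M for every z ∈ O_M. Then for every x ∈ O_M and every integer k ≥ 0, the element F(x^{p^k}) − x^{p^{q+k}} lies in the ideal of O_M generated by the elements p^i·π_M^{p^{k−i}} for 0 ≤ i ≤ k (equivalently, its valuation is at least k·e + min_{0 ≤ i ≤ k}(p^i − i·e)). -/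
/-- If `p` does not divide `m`, then `p ^ (k - v)` divides `(p ^ k).choose (p ^ v * m)`. -/
theorem Nat.Prime.pow_sub_dvd_choose_pow {p : ℕ} (hp : p.Prime) {k v m : ℕ} (hv : v ≤ k)
    (hm : ¬ p ∣ m) : p ^ (k - v) ∣ (p ^ k).choose (p ^ v * m) := by
  have hm0 : 0 < m := Nat.pos_of_ne_zero fun h => hm (h ▸ dvd_zero p)
  have hj : 0 < p ^ v * m := Nat.mul_pos (pow_pos hp.pos v) hm0
  have hk : 0 < p ^ k := pow_pos hp.pos k
  have h := Nat.add_one_mul_choose_eq (p ^ k - 1) (p ^ v * m - 1)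
  rw [Nat.sub_add_cancel hk, Nat.sub_add_cancel hj] at h
  have hdvd : p ^ v * p ^ (k - v) ∣ p ^ v * ((p ^ k).choose (p ^ v * m) * m) := by
    rw [← pow_add, Nat.add_sub_cancel' hv]
    exact ⟨_, by rw [h]; ring⟩
  exact ((hp.coprime_iff_not_dvd.2 hm).pow_left _).dvd_of_dvd_mul_right
    (Nat.dvd_of_mul_dvd_mul_left (pow_pos hp.pos v) hdvd)

/-- The `p ^ k`-th powers of `π * c + b` and `b` are congruent modulo
the ideal generated by the `p ^ i * π ^ (p ^ (k - i))` for `i ≤ k`. -/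
theorem add_mul_pow_prime_pow_sub_mem_span {R : Type*} [CommRing R] {p : ℕ} (hp : p.Prime)
    (π b c : R) (k : ℕ) :
    (π * c + b) ^ (p ^ k) - b ^ (p ^ k) ∈
      Ideal.span ((fun i : ℕ => (p : R) ^ i * π ^ (p ^ (k - i))) '' {i : ℕ | i ≤ k}) := by
  rw [add_pow, Finset.sum_range_succ']
  simp only [pow_zero, one_mul, Nat.sub_zero, Nat.choose_zero_right, Nat.cast_one, mul_one,
    add_sub_cancel_right]
  refine Ideal.sum_mem _ fun j hj => ?_
  obtain ⟨v, m, hm, hvm⟩ := Nat.exists_eq_pow_mul_and_not_dvd j.succ_ne_zero p hp.ne_one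
  rw [Nat.succ_eq_add_one] at hvm
  have hm0 : 0 < m := Nat.pos_of_ne_zero fun h => hm (h ▸ dvd_zero p)
  have hle : p ^ v ≤ j + 1 := hvm ▸ Nat.le_mul_of_pos_right _ hm0
  have hv : v ≤ k :=
    (Nat.pow_le_pow_iff_right hp.one_lt).1 (hle.trans (Finset.mem_range.1 hj))
  have hgen : (p : R) ^ (k - v) * π ^ (p ^ v) ∈
      Ideal.span ((fun i : ℕ => (p : R) ^ i * π ^ (p ^ (k - i))) '' {i : ℕ | i ≤ k}) :=
    Ideal.subset_span ⟨k - v, Nat.sub_le k v, by simp only [Nat.sub_sub_self hv]⟩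
  refine Ideal.mem_of_dvd _ ?_ hgen
  have hchoose : (p : R) ^ (k - v) ∣ ((p ^ k).choose (j + 1) : R) := by
    have h := Nat.cast_dvd_cast (α := R) (hvm ▸ hp.pow_sub_dvd_choose_pow hv hm)
    rwa [Nat.cast_pow] at h
  rw [mul_comm, mul_pow]
  exact mul_dvd_mul (dvd_mul_of_dvd_left (dvd_mul_of_dvd_left (pow_dvd_pow π hle) _) _) hchoose

/-- Let `M` be a finite extension of `ℚ_p` with valuation ring `O_M`
(the integral closure of `ℤ_p` in `M`), uniformizer `π`, and ramification index `e`
(so `p·O_M = π^e·O_M`).  Let `q ≥ 1` and let `F : O_M → O_M` be a ring homomorphism with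
`F z - z^(p^q) ∈ π·O_M` for every `z ∈ O_M` (a lifted Frobenius).  Then for every
`x ∈ O_M` and every `k ≥ 0`, the element `F(x^(p^k)) - x^(p^(q+k))` lies in the ideal of
`O_M` generated by the elements `p^i·π^(p^(k-i))` for `0 ≤ i ≤ k`. -/
theorem lifted_frobenius_pow_congruence
    (p : ℕ) [Fact p.Prime]
    (M : Type*) [Field M] [Algebra ℚ_[p] M] [FiniteDimensional ℚ_[p] M]
    [Algebra ℤ_[p] M] [IsScalarTower ℤ_[p] ℚ_[p] M]
    (π : integralClosure ℤ_[p] M) (hπ : Irreducible π)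
    (e : ℕ) (he : 1 ≤ e)
    (hpe : Ideal.span {(p : integralClosure ℤ_[p] M)} = Ideal.span {π ^ e})
    (q : ℕ) (hq : 1 ≤ q)
    (F : integralClosure ℤ_[p] M →+* integralClosure ℤ_[p] M)
    (hF : ∀ z : integralClosure ℤ_[p] M, F z - z ^ (p ^ q) ∈ Ideal.span {π})
    (x : integralClosure ℤ_[p] M) (k : ℕ) :
    F (x ^ (p ^ k)) - x ^ (p ^ (q + k)) ∈
      Ideal.span ((fun i : ℕ => (p : integralClosure ℤ_[p] M) ^ i * π ^ (p ^ (k - i))) ''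
        {i : ℕ | i ≤ k}) := by
  obtain ⟨c, hc⟩ := Ideal.mem_span_singleton.1 (hF x)
  rw [map_pow, eq_add_of_sub_eq hc, pow_add, pow_mul]
  exact add_mul_pow_prime_pow_sub_mem_span Fact.out π _ c k
end

section
/- Let M be a finite extension of Q_p with valuation ring O_M, uniformizer π_M, and ramification index e over Q_p. Then the O_M-submodule of M generated by the elements π_M^{p^k}·p^{−k} for k ≥ 0 is the principal fractional ideal generated by π_M^{m}, where m = min_{k ≥ 0}(p^k − k·e); in particular this minimum exists because p^k − k·e → ∞ as k → ∞. In the special case where M/Q_p is unramified (e = 1), this submodule is p·O_M. -/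
/-- If `q` generates the same ideal as `π ^ e`, each `π ^ a k / q ^ k` is a unit multiple of
`π ^ (a k - k * e)`, so these elements span the fractional ideal of the least such power. -/
theorem span_pow_div_pow_eq_span_zpow {R K : Type*} [CommRing R] [IsDomain R] [Field K]
    [Algebra R K] {π q : R} (hπ : algebraMap R K π ≠ 0) {e : ℕ}
    (hq : Ideal.span {q} = Ideal.span {π ^ e}) (a : ℕ → ℕ) {m : ℤ}
    (hm : IsLeast {v : ℤ | ∃ k : ℕ, v = (a k : ℤ) - (k : ℤ) * e} m) :
    Submodule.span R {x : K | ∃ k : ℕ, x = algebraMap R K π ^ a k / algebraMap R K q ^ k} =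
      Submodule.span R {algebraMap R K π ^ m} := by
  obtain ⟨u, hu⟩ := (Ideal.span_singleton_eq_span_singleton.mp hq)
  have hq0 : algebraMap R K q ≠ 0 := by
    intro h
    apply pow_ne_zero e hπ
    rw [← map_pow, ← hu, map_mul, h, zero_mul]
  have key (k : ℕ) : algebraMap R K π ^ a k / algebraMap R K q ^ k =
      (u : R) ^ k • algebraMap R K π ^ ((a k : ℤ) - (k : ℤ) * e) := by
    have hu' : algebraMap R K q * algebraMap R K (u : R) = algebraMap R K π ^ e := by
      rw [← map_mul, hu, map_pow]
    rw [Algebra.smul_def, map_pow, zpow_sub₀ hπ, zpow_natCast, mul_comm (k : ℤ), zpow_mul,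
      zpow_natCast, zpow_natCast, ← hu', mul_pow]
    have hu0 : algebraMap R K (u : R) ≠ 0 := (u.isUnit.map (algebraMap R K)).ne_zero
    field_simp
  apply le_antisymm
  · rw [Submodule.span_le]
    rintro x ⟨k, rfl⟩
    obtain ⟨n, hn⟩ := Int.le.dest (hm.2 ⟨k, rfl⟩)
    rw [key, ← hn, zpow_add₀ hπ, zpow_natCast, SetLike.mem_coe]
    refine Submodule.smul_mem _ _ (Submodule.mem_span_singleton.mpr ⟨π ^ n, ?_⟩)
    rw [Algebra.smul_def, map_pow, mul_comm]
  · rw [Submodule.span_singleton_le_iff_mem]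
    obtain ⟨k, rfl⟩ := hm.1
    have h := Submodule.smul_mem _ ((↑(u⁻¹ ^ k) : R))
      (Submodule.subset_span (R := R) (s := {x : K | ∃ k : ℕ,
        x = algebraMap R K π ^ a k / algebraMap R K q ^ k}) ⟨k, rfl⟩)
    rwa [key, smul_smul, ← Units.val_pow_eq_pow_val, ← Units.val_mul, ← mul_pow,
      inv_mul_cancel, one_pow, Units.val_one, one_smul] at h

theorem neg_sq_le_pow_sub_mul {p : ℕ} (hp : 2 ≤ p) (e k : ℕ) :
    -(e : ℤ) ^ 2 ≤ (p : ℤ) ^ k - (k : ℤ) * e := by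
  have hpk : (0 : ℤ) ≤ (p : ℤ) ^ k := by positivity
  rcases le_total k e with h | h
  · have : (k : ℤ) ≤ e := by exact_mod_cast h
    nlinarith
  · obtain ⟨n, rfl⟩ := Nat.exists_eq_add_of_le h
    have h1 : e * n ≤ p ^ (e + n) := by
      rw [pow_add]
      exact Nat.mul_le_mul (Nat.lt_pow_self hp).le (Nat.lt_pow_self hp).le
    zify at h1
    push_cast
    nlinarith

/-- The values `p ^ k - k * e` have a minimum. -/
theorem exists_isLeast_pow_sub_mul {p : ℕ} (hp : 2 ≤ p) (e : ℕ) :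
    ∃ m : ℤ, IsLeast {v : ℤ | ∃ k : ℕ, v = (p : ℤ) ^ k - (k : ℤ) * e} m := by
  obtain ⟨m, hm, hle⟩ := Int.exists_least_of_bdd
    (P := fun v : ℤ => ∃ k : ℕ, v = (p : ℤ) ^ k - (k : ℤ) * e)
    ⟨-(e : ℤ) ^ 2, by rintro _ ⟨k, rfl⟩; exact neg_sq_le_pow_sub_mul hp e k⟩ ⟨_, 0, rfl⟩
  exact ⟨m, hm, hle⟩

theorem isLeast_one_pow_sub {p : ℕ} (hp : 2 ≤ p) :
    IsLeast {v : ℤ | ∃ k : ℕ, v = (p : ℤ) ^ k - (k : ℤ) * (1 : ℕ)} 1 := by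
  refine ⟨⟨0, by simp⟩, ?_⟩
  rintro _ ⟨k, rfl⟩
  have h : k < p ^ k := Nat.lt_pow_self hp
  zify at h
  push_cast
  linarith


/-- Let `M` be a finite extension of `ℚ_p` with valuation ring `O_M`
(the integral closure of `ℤ_p` in `M`), uniformizer `π`, and ramification index `e`
(so `p·O_M = π^e·O_M`).  Then the minimum `m = min_{k ≥ 0} (p^k - k·e)` exists (the values
`p^k - k·e` tend to infinity), and the `O_M`-submodule of `M` generated by the elements
`π^(p^k)·p^(-k)`, `k ≥ 0`, is the principal fractional ideal generated by `π^m`.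
In the special case `e = 1` (`M/ℚ_p` unramified) this submodule is `p·O_M`. -/
theorem span_pi_pow_div_p_pow_eq_span_pi_zpow_min
    (p : ℕ) [Fact p.Prime]
    (M : Type*) [Field M] [Algebra ℚ_[p] M] [FiniteDimensional ℚ_[p] M]
    [Algebra ℤ_[p] M] [IsScalarTower ℤ_[p] ℚ_[p] M]
    (π : integralClosure ℤ_[p] M) (hπ : Irreducible π)
    (e : ℕ) (he : 1 ≤ e)
    (hpe : Ideal.span {(p : integralClosure ℤ_[p] M)} = Ideal.span {π ^ e}) :
    (∃ m : ℤ, IsLeast {v : ℤ | ∃ k : ℕ, v = (p : ℤ) ^ k - (k : ℤ) * e} m ∧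
        Submodule.span (integralClosure ℤ_[p] M)
            {x : M | ∃ k : ℕ, x = (π : M) ^ (p ^ k) / (p : M) ^ k} =
          Submodule.span (integralClosure ℤ_[p] M) {(π : M) ^ m}) ∧
      (e = 1 →
        Submodule.span (integralClosure ℤ_[p] M)
            {x : M | ∃ k : ℕ, x = (π : M) ^ (p ^ k) / (p : M) ^ k} =
          Submodule.span (integralClosure ℤ_[p] M) {(p : M)}) := by
  have hp : 2 ≤ p := (Fact.out : p.Prime).two_le
  have hπ0 : algebraMap (integralClosure ℤ_[p] M) M π ≠ 0 := fun h =>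
    hπ.ne_zero (Subtype.ext h)
  have key (m : ℤ) (hm : IsLeast {v : ℤ | ∃ k : ℕ, v = (p : ℤ) ^ k - (k : ℤ) * e} m) :
      Submodule.span (integralClosure ℤ_[p] M)
          {x : M | ∃ k : ℕ, x = (π : M) ^ (p ^ k) / (p : M) ^ k} =
        Submodule.span (integralClosure ℤ_[p] M) {(π : M) ^ m} := by
    have h := span_pow_div_pow_eq_span_zpow hπ0 hpe (fun k => p ^ k) (m := m)
      (by simpa only [Nat.cast_pow] using hm)
    rwa [map_natCast] at h
  refine ⟨?_, ?_⟩
  · obtain ⟨m, hm⟩ := exists_isLeast_pow_sub_mul hp e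
    exact ⟨m, hm, key m hm⟩
  · rintro rfl
    rw [key 1 (isLeast_one_pow_sub hp), zpow_one]
    have h := congrArg (Submodule.map (Algebra.linearMap (integralClosure ℤ_[p] M) M)) hpe
    rw [Ideal.span, Ideal.span, Submodule.map_span, Submodule.map_span, Set.image_singleton,
      Set.image_singleton, pow_one, Algebra.linearMap_apply, Algebra.linearMap_apply,
      map_natCast] at h
    exact h.symm
end
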